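/- arXiv:2009.11938 — 2 statements merged into one kernel-verified Lean document; each statement's English description precedes it below -/
import Mathlib

section
/- For every simple undirected graph G on N vertices, the minimum rank of G satisfies mr(G) ≥ N − Z(G), where Z(G) is the zero forcing number of G. -/
/-- The zero forcing closure of a set `S` of vertices of `G`: the set of vertices that
eventually become black when starting from `S` black and repeatedly applying the rule
"a black vertex with exactly one white neighbour forces that neighbour black". -/
inductive SimpleGraph.ZFClosure {V : Type*} (G : SimpleGraph V) (S : Set V) : V → Prop
  | init (v : V) : v ∈ S → SimpleGraph.ZFClosure G S v
  | force (u w : V) : SimpleGraph.ZFClosure G S u → G.Adj u w →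
      (∀ x, G.Adj u x → x ≠ w → SimpleGraph.ZFClosure G S x) →
      SimpleGraph.ZFClosure G S w

/-- `S` is a zero forcing set of `G` if its closure is the whole vertex set. -/
def SimpleGraph.IsZeroForcingSet {V : Type*} (G : SimpleGraph V) (S : Set V) : Prop :=
  ∀ v, G.ZFClosure S v

/-- The zero forcing number of `G`: minimum size of a zero forcing set. -/
noncomputable def SimpleGraph.zeroForcingNumber {V : Type*} (G : SimpleGraph V) [Fintype V] : ℕ :=
  sInf {n | ∃ S : Finset V, S.card = n ∧ G.IsZeroForcingSet ↑S}

/-- The minimum rank of `G`: the minimum rank over all real symmetric matrices whose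
off-diagonal zero/nonzero pattern is given by the (non-)edges of `G`. -/
noncomputable def SimpleGraph.minRank {V : Type*} (G : SimpleGraph V)
    [Fintype V] [DecidableEq V] : ℕ :=
  sInf {r | ∃ A : Matrix V V ℝ, A.IsSymm ∧
    (∀ i j, i ≠ j → (A i j ≠ 0 ↔ G.Adj i j)) ∧ A.rank = r}

/-- A vector in the kernel of a matrix with off-diagonal pattern `G` which vanishes on `S`
vanishes on the zero forcing closure of `S`. -/
theorem SimpleGraph.ZFClosure.apply_eq_zero {V : Type*} [Fintype V] {G : SimpleGraph V}
    {S : Set V} {A : Matrix V V ℝ} (hA : ∀ i j, i ≠ j → (A i j ≠ 0 ↔ G.Adj i j))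
    {x : V → ℝ} (hx : A.mulVec x = 0) (hS : ∀ v ∈ S, x v = 0) {v : V}
    (hv : G.ZFClosure S v) : x v = 0 := by
  induction hv with
  | init v hv => exact hS v hv
  | force u w _ huw _ hu hnbr =>
    have hsum : ∑ j, A u j * x j = 0 := congrFun hx u
    rw [Fintype.sum_eq_single w] at hsum
    · exact (mul_eq_zero.mp hsum).resolve_left ((hA u w huw.ne).mpr huw)
    · intro j hj
      by_cases huj : u = j
      · rw [← huj, hu, mul_zero]
      · by_cases hadj : G.Adj u j
        · rw [hnbr j hadj hj, mul_zero]
        · rw [not_not.mp (mt (hA u j huj).mp hadj), zero_mul]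

/-- The nullity of a matrix with off-diagonal pattern `G` is at most the size of any
zero forcing set of `G`. -/
theorem SimpleGraph.IsZeroForcingSet.card_le_rank_add_card {V : Type*} [Fintype V]
    {G : SimpleGraph V} {S : Finset V} (hS : G.IsZeroForcingSet ↑S)
    {A : Matrix V V ℝ} (hA : ∀ i j, i ≠ j → (A i j ≠ 0 ↔ G.Adj i j)) :
    Fintype.card V ≤ A.rank + S.card := by
  have hinj : Function.Injective
      ((LinearMap.funLeft ℝ ℝ (Subtype.val : S → V)).comp A.mulVecLin.ker.subtype) := by
    rw [injective_iff_map_eq_zero]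
    rintro ⟨x, hx⟩ hxS
    ext v
    exact (hS v).apply_eq_zero hA hx fun w hw ↦ congrFun hxS ⟨w, hw⟩
  have hker := LinearMap.finrank_le_finrank_of_injective hinj
  have hrank := A.mulVecLin.finrank_range_add_finrank_ker
  rw [Module.finrank_fintype_fun_eq_card] at hker hrank
  rw [Fintype.card_coe] at hker
  rw [Matrix.rank]
  omega

/-- For every simple undirected graph `G` on `N` vertices,
`mr(G) ≥ N − Z(G)`. -/
theorem minRank_ge_card_sub_zeroForcingNumber {V : Type*} [Fintype V] [DecidableEq V]
    (G : SimpleGraph V) :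
    G.minRank ≥ Fintype.card V - G.zeroForcingNumber := by
  classical
  obtain ⟨S, hcard, hS⟩ : G.zeroForcingNumber ∈
      {n | ∃ S : Finset V, S.card = n ∧ G.IsZeroForcingSet ↑S} :=
    Nat.sInf_mem ⟨_, Finset.univ, rfl, fun v ↦ .init v (Finset.mem_coe.mpr (Finset.mem_univ v))⟩
  obtain ⟨A, -, hA, hrank⟩ : G.minRank ∈ {r | ∃ A : Matrix V V ℝ, A.IsSymm ∧
      (∀ i j, i ≠ j → (A i j ≠ 0 ↔ G.Adj i j)) ∧ A.rank = r} :=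
    Nat.sInf_mem ⟨_, G.adjMatrix ℝ, G.isSymm_adjMatrix, fun i j _ ↦ by
      simp [SimpleGraph.adjMatrix_apply], rfl⟩
  have hle := hS.card_le_rank_add_card hA
  omega
end

section
/- If T is a tree on N vertices, then the minimum rank of T equals N − Z(T), i.e. mr(T) = N − Z(T). -/
namespace SimpleGraph

variable {V : Type*}

/-- `G` cannot force from `u` any vertex outside `X`. -/
def StalledAt (G : SimpleGraph V) (X : Set V) (u : V) : Prop :=
  ∀ w, G.Adj u w → (∀ x, G.Adj u x → x ≠ w → x ∈ X) → w ∈ X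

/-- Starting from `S`, and forcing only from vertices of `F`, every vertex of `W` becomes black. -/
def Forces (G : SimpleGraph V) (F W S : Finset V) : Prop :=
  ∀ X : Set V, (∀ s ∈ S, s ∈ X) → (∀ u ∈ F, u ∈ X → G.StalledAt X u) → ∀ v ∈ W, v ∈ X

theorem Forces.isZeroForcingSet [Fintype V] {G : SimpleGraph V} {S : Finset V}
    (h : G.Forces Finset.univ Finset.univ S) : G.IsZeroForcingSet (S : Set V) := fun v =>
  h {v | G.ZFClosure S v} (fun s hs => .init s hs)
    (fun u _ hu w huw hx => .force u w hu huw hx) v (Finset.mem_univ v)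

/-- `A` is symmetric with off-diagonal nonzero pattern `R`. -/
def HasPattern (A : Matrix V V ℝ) (R : V → V → Prop) : Prop :=
  A.IsSymm ∧ ∀ i j, i ≠ j → (A i j ≠ 0 ↔ R i j)

theorem HasPattern.congr {A : Matrix V V ℝ} {R R' : V → V → Prop} (h : HasPattern A R)
    (hR : ∀ i j, i ≠ j → (R i j ↔ R' i j)) : HasPattern A R' :=
  ⟨h.1, fun i j hij => (h.2 i j hij).trans (hR i j hij)⟩

theorem HasPattern.add {A B : Matrix V V ℝ} {R R' : V → V → Prop} (hA : HasPattern A R)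
    (hB : HasPattern B R') (hd : ∀ i j, i ≠ j → R i j → ¬ R' i j) :
    HasPattern (A + B) fun i j => R i j ∨ R' i j := by
  refine ⟨hA.1.add hB.1, fun i j hij => ?_⟩
  have h1 := hA.2 i j hij
  have h2 := hB.2 i j hij
  have h3 := hd i j hij
  rw [Matrix.add_apply]
  by_cases h : R i j
  · have : B i j = 0 := by tauto
    simp [this, h, h1]
  · have : A i j = 0 := by tauto
    simp [this, h, h2]

theorem rank_matrix_add_le [Fintype V] (A B : Matrix V V ℝ) :
    (A + B).rank ≤ A.rank + B.rank := by
  rw [Matrix.rank, Matrix.mulVecLin_add]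
  exact (Submodule.finrank_mono (LinearMap.range_add_le _ _)).trans
    (Submodule.finrank_add_le_finrank_add_finrank _ _)

theorem exists_hasPattern_edge [Fintype V] (r c : V) :
    ∃ A : Matrix V V ℝ, A.rank ≤ 1 ∧
      HasPattern A fun i j => (i = r ∧ j = c) ∨ (i = c ∧ j = r) := by
  classical
  refine ⟨Matrix.vecMulVec (fun i => if i = r ∨ i = c then 1 else 0)
    (fun i => if i = r ∨ i = c then 1 else 0), Matrix.rank_vecMulVec_le _ _, ?_, ?_⟩
  · ext i j
    simp [Matrix.vecMulVec_apply, mul_comm]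
  · intro i j hij
    simp only [Matrix.vecMulVec_apply]
    grind

theorem exists_hasPattern_star [Fintype V] (r : V) (p : V → Prop) :
    ∃ A : Matrix V V ℝ, A.rank ≤ 2 ∧
      HasPattern A fun i j => (i = r ∧ p j) ∨ (j = r ∧ p i) := by
  classical
  set e : V → ℝ := fun i => if i = r then 1 else 0 with he
  set u : V → ℝ := fun i => if p i then 1 else 0 with hu
  refine ⟨Matrix.vecMulVec e u + Matrix.vecMulVec u e, ?_, ?_, ?_⟩
  · have h1 := rank_matrix_add_le (Matrix.vecMulVec e u) (Matrix.vecMulVec u e)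
    have h2 := Matrix.rank_vecMulVec_le e u
    have h3 := Matrix.rank_vecMulVec_le u e
    omega
  · ext i j
    simp [Matrix.vecMulVec_apply, mul_comm, add_comm]
  · intro i j hij
    simp only [Matrix.add_apply, Matrix.vecMulVec_apply, he, hu]
    grind

/-- The root `r` of the component `W` may end a path of an optimal path cover: `n` bounds the size
of a forcing set in which `r` never forces, and of one containing `r`. -/
def IsExtendable [Fintype V] [DecidableEq V] (G : SimpleGraph V) (W : Finset V) (r : V) (n ε : ℕ) :
    Prop :=
  (∃ A : Matrix V V ℝ, HasPattern A (fun i j => i ∈ W ∧ G.Adj i j) ∧ A.rank + n ≤ W.card) ∧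
  (∃ S : Finset V, r ∈ S ∧ S.card ≤ n ∧ G.Forces W W S) ∧
  (∃ S : Finset V, (ε = 0 → r ∈ S) ∧ S.card ≤ n ∧ G.Forces (W.erase r) W S) ∧
  ∃ B : Matrix V V ℝ, HasPattern B (fun i j => i ∈ W ∧ G.Adj i j ∧ i ≠ r ∧ j ≠ r) ∧
    B.rank + ε + n ≤ W.card

/-- Deleting the root `r` of the component `W` lowers the rank by two. -/
def IsDeletable [Fintype V] (G : SimpleGraph V) (W : Finset V) (r : V) (n : ℕ) : Prop :=
  (∃ S : Finset V, S.card ≤ n ∧ G.Forces W W S) ∧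
  ∃ B : Matrix V V ℝ, HasPattern B (fun i j => i ∈ W ∧ G.Adj i j ∧ i ≠ r ∧ j ≠ r) ∧
    B.rank + 2 + n ≤ W.card

/-- `G` is `G'` with an additional edge from `r` to `c`, where `r` and `c` lie in disjoint unions
`W₁` and `W₂` of components of `G'`. -/
structure IsEdgeJoin (G G' : SimpleGraph V) (W₁ W₂ : Finset V) (r c : V) : Prop where
  adj_iff : ∀ i j, G.Adj i j ↔ G'.Adj i j ∨ (i = r ∧ j = c) ∨ (i = c ∧ j = r)
  left_mem : r ∈ W₁
  right_mem : c ∈ W₂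
  disj : ∀ v ∈ W₁, v ∉ W₂
  left_closed : ∀ i j, G'.Adj i j → (i ∈ W₁ ↔ j ∈ W₁)
  right_closed : ∀ i j, G'.Adj i j → (i ∈ W₂ ↔ j ∈ W₂)

namespace IsEdgeJoin

variable {G G' : SimpleGraph V} {W₁ W₂ : Finset V} {r c : V}

theorem symm (h : IsEdgeJoin G G' W₁ W₂ r c) : IsEdgeJoin G G' W₂ W₁ c r where
  adj_iff i j := by rw [h.adj_iff]; tauto
  left_mem := h.right_mem
  right_mem := h.left_mem
  disj v h2 h1 := h.disj v h1 h2
  left_closed := h.right_closed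
  right_closed := h.left_closed

theorem ne (h : IsEdgeJoin G G' W₁ W₂ r c) : r ≠ c := fun e =>
  h.disj r h.left_mem (e ▸ h.right_mem)

theorem stalledAt (h : IsEdgeJoin G G' W₁ W₂ r c) {X : Set V} {u : V} (hu : u ∈ W₁)
    (hc : u = r → c ∈ X) (hX : G.StalledAt X u) : G'.StalledAt X u := by
  intro w huw hw
  refine hX w ((h.adj_iff u w).2 (.inl huw)) fun x hux hxw => ?_
  rcases (h.adj_iff u x).1 hux with h1 | ⟨h1, rfl⟩ | ⟨rfl, -⟩
  · exact hw x h1 hxw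
  · exact hc h1
  · exact absurd h.right_mem (h.disj _ hu)

/-- If `W₁` is black and `r` is stalled, then `c` is black. -/
theorem right_mem_of_subset (h : IsEdgeJoin G G' W₁ W₂ r c) {X : Set V} (hW : ∀ v ∈ W₁, v ∈ X)
    (hX : G.StalledAt X r) : c ∈ X := by
  refine hX c ((h.adj_iff r c).2 (by simp)) fun x hrx hxc => ?_
  rcases (h.adj_iff r x).1 hrx with h1 | ⟨-, h1⟩ | ⟨h1, -⟩
  · exact hW x ((h.left_closed r x h1).1 h.left_mem)
  · exact absurd h1 hxc
  · exact absurd h1 h.ne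

variable [DecidableEq V]

theorem forces_union (h : IsEdgeJoin G G' W₁ W₂ r c) {S₁ S₂ : Finset V}
    (h₁ : G'.Forces W₁ W₁ S₁) (h₂ : G'.Forces W₂ W₂ S₂) :
    G.Forces (W₁ ∪ W₂) (W₁ ∪ W₂) (S₁ ∪ S₂) := by
  intro X hS hX
  have left : (r ∈ X → c ∈ X) → ∀ v ∈ W₁, v ∈ X := fun hrc =>
    h₁ X (fun s hs => hS s (Finset.mem_union_left _ hs)) fun u hu huX =>
      h.stalledAt hu (fun e => hrc (e ▸ huX)) (hX u (Finset.mem_union_left _ hu) huX)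
  have right : (c ∈ X → r ∈ X) → ∀ v ∈ W₂, v ∈ X := fun hrc =>
    h₂ X (fun s hs => hS s (Finset.mem_union_right _ hs)) fun u hu huX =>
      h.symm.stalledAt hu (fun e => hrc (e ▸ huX)) (hX u (Finset.mem_union_right _ hu) huX)
  have hr : r ∈ X := by
    by_contra hr
    exact hr (left (fun h => absurd h hr) r h.left_mem)
  have hc : c ∈ X := by
    by_contra hc
    exact hc (right (fun h => absurd h hc) c h.right_mem)
  intro v hv
  rcases Finset.mem_union.1 hv with hv | hv
  · exact left (fun _ => hc) v hv
  · exact right (fun _ => hr) v hv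

theorem forces_erase_union (h : IsEdgeJoin G G' W₁ W₂ r c) {S₁ S₂ : Finset V}
    (h₁ : G'.Forces (W₁.erase r) W₁ S₁) (h₂ : G'.Forces W₂ W₂ S₂) :
    G.Forces ((W₁ ∪ W₂).erase r) (W₁ ∪ W₂) (S₁ ∪ S₂) := by
  intro X hS hX
  have left : ∀ v ∈ W₁, v ∈ X :=
    h₁ X (fun s hs => hS s (Finset.mem_union_left _ hs)) fun u hu huX =>
      h.stalledAt (Finset.mem_of_mem_erase hu) (fun e => absurd e (Finset.ne_of_mem_erase hu))
        (hX u (by grind) huX)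
  have right : ∀ v ∈ W₂, v ∈ X :=
    h₂ X (fun s hs => hS s (Finset.mem_union_right _ hs)) fun u hu huX =>
      h.symm.stalledAt hu (fun _ => left r h.left_mem)
        (hX u (by have := h.disj r h.left_mem; grind) huX)
  intro v hv
  exact (Finset.mem_union.1 hv).elim (left v) (right v)

/-- The root `r` ends its path in `W₁`, and forces `c` at the end. -/
theorem forces_union_erase (h : IsEdgeJoin G G' W₁ W₂ r c) {S₁ S₂ : Finset V}
    (h₁ : G'.Forces (W₁.erase r) W₁ S₁) (h₂ : G'.Forces W₂ W₂ S₂) :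
    G.Forces (W₁ ∪ W₂) (W₁ ∪ W₂) (S₁ ∪ S₂.erase c) := by
  intro X hS hX
  have left : ∀ v ∈ W₁, v ∈ X :=
    h₁ X (fun s hs => hS s (Finset.mem_union_left _ hs)) fun u hu huX =>
      h.stalledAt (Finset.mem_of_mem_erase hu) (fun e => absurd e (Finset.ne_of_mem_erase hu))
        (hX u (by grind) huX)
  have hr := left r h.left_mem
  have hc : c ∈ X :=
    h.right_mem_of_subset left (hX r (Finset.mem_union_left _ h.left_mem) hr)
  have right : ∀ v ∈ W₂, v ∈ X :=
    h₂ X (fun s hs => by by_cases e : s = c <;> grind) fun u hu huX =>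
      h.symm.stalledAt hu (fun _ => hr) (hX u (Finset.mem_union_right _ hu) huX)
  intro v hv
  exact (Finset.mem_union.1 hv).elim (left v) (right v)

/-- The vertex `c` ends its path in `W₂`, and forces `r`, which itself never forces. -/
theorem forces_erase_erase_union (h : IsEdgeJoin G G' W₁ W₂ r c) {S₁ S₂ : Finset V}
    (h₁ : G'.Forces (W₁.erase r) W₁ S₁) (h₂ : G'.Forces (W₂.erase c) W₂ S₂) :
    G.Forces ((W₁ ∪ W₂).erase r) (W₁ ∪ W₂) (S₁.erase r ∪ S₂) := by
  intro X hS hX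
  have hrW := h.disj r h.left_mem
  have right : ∀ v ∈ W₂, v ∈ X :=
    h₂ X (fun s hs => hS s (Finset.mem_union_right _ hs)) fun u hu huX =>
      h.symm.stalledAt (Finset.mem_of_mem_erase hu)
        (fun e => absurd e (Finset.ne_of_mem_erase hu)) (hX u (by grind) huX)
  have hr : r ∈ X := h.symm.right_mem_of_subset right
    (hX c (by have := h.ne; have := h.right_mem; grind) (right c h.right_mem))
  have left : ∀ v ∈ W₁, v ∈ X :=
    h₁ X (fun s hs => by by_cases e : s = r <;> grind) fun u hu huX =>
      h.stalledAt (Finset.mem_of_mem_erase hu) (fun e => absurd e (Finset.ne_of_mem_erase hu))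
        (hX u (by grind) huX)
  intro v hv
  exact (Finset.mem_union.1 hv).elim (left v) (right v)

theorem card_union (h : IsEdgeJoin G G' W₁ W₂ r c) : (W₁ ∪ W₂).card = W₁.card + W₂.card :=
  Finset.card_union_of_disjoint (Finset.disjoint_left.2 h.disj)

theorem hasPattern_delete_add (h : IsEdgeJoin G G' W₁ W₂ r c) {B A : Matrix V V ℝ}
    (hB : HasPattern B fun i j => i ∈ W₁ ∧ G'.Adj i j ∧ i ≠ r ∧ j ≠ r)
    (hA : HasPattern A fun i j => i ∈ W₂ ∧ G'.Adj i j) :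
    HasPattern (B + A) fun i j => i ∈ W₁ ∪ W₂ ∧ G.Adj i j ∧ i ≠ r ∧ j ≠ r := by
  refine (hB.add hA fun i j _ hi hj => h.disj i hi.1 hj.1).congr fun i j hij => ?_
  have h1 := h.adj_iff i j
  have h2 := h.right_closed i j
  have h3 := h.disj r h.left_mem
  grind

theorem hasPattern_add_edge (h : IsEdgeJoin G G' W₁ W₂ r c) {A₁ A₂ E : Matrix V V ℝ}
    (h₁ : HasPattern A₁ fun i j => i ∈ W₁ ∧ G'.Adj i j)
    (h₂ : HasPattern A₂ fun i j => i ∈ W₂ ∧ G'.Adj i j)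
    (hE : HasPattern E fun i j => (i = r ∧ j = c) ∨ (i = c ∧ j = r)) :
    HasPattern (A₁ + A₂ + E) fun i j => i ∈ W₁ ∪ W₂ ∧ G.Adj i j := by
  have hr := h.left_mem
  have hc := h.right_mem
  have hr' := h.disj r hr
  have hc' : c ∉ W₁ := fun hc' => h.disj c hc' hc
  refine ((h₁.add h₂ fun i j _ hi hj => h.disj i hi.1 hj.1).add hE ?_).congr ?_
  · intro i j hij
    have h2 := h.right_closed i j
    have h3 := h.left_closed i j
    grind
  · intro i j hij
    have h1 := h.adj_iff i j
    grind

theorem hasPattern_add_star (h : IsEdgeJoin G G' W₁ W₂ r c) {A B E : Matrix V V ℝ}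
    (hA : HasPattern A fun i j => i ∈ W₁ ∧ G'.Adj i j)
    (hB : HasPattern B fun i j => i ∈ W₂ ∧ G'.Adj i j ∧ i ≠ c ∧ j ≠ c)
    (hE : HasPattern E fun i j => (i = c ∧ G.Adj c j) ∨ (j = c ∧ G.Adj c i)) :
    HasPattern (A + B + E) fun i j => i ∈ W₁ ∪ W₂ ∧ G.Adj i j := by
  have hr := h.left_mem
  have hc := h.right_mem
  have hr' := h.disj r hr
  have hc' : c ∉ W₁ := fun hc' => h.disj c hc' hc
  refine ((hA.add hB fun i j _ hi hj => h.disj i hi.1 hj.1).add hE ?_).congr ?_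
  · intro i j hij
    have h2 := h.right_closed i j
    have h3 := h.left_closed i j
    grind
  · intro i j hij
    have h1 := h.adj_iff i j
    have h2 := h.right_closed i j
    have h3 := G.adj_comm i j
    grind

end IsEdgeJoin

theorem IsDeletable.exists_matrix [Fintype V] {G : SimpleGraph V} {W : Finset V} {r : V} {n : ℕ}
    (h : G.IsDeletable W r n) (hr : r ∈ W)
    (hW : ∀ i j, G.Adj i j → (i ∈ W ↔ j ∈ W)) :
    ∃ A : Matrix V V ℝ, HasPattern A (fun i j => i ∈ W ∧ G.Adj i j) ∧ A.rank + n ≤ W.card := by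
  obtain ⟨-, B, hB, hBn⟩ := h
  obtain ⟨E, hE2, hE⟩ := exists_hasPattern_star r (G.Adj r)
  refine ⟨B + E, (hB.add hE (by grind)).congr fun i j hij => ?_, ?_⟩
  · have h2 := hW i j
    have h3 := G.adj_comm i j
    grind
  · have := rank_matrix_add_le B E
    omega

section Join

variable [Fintype V] [DecidableEq V] {G G' : SimpleGraph V} {W W₁ W₂ : Finset V} {r c : V}
  {n n₁ n₂ ε : ℕ}

theorem IsDeletable.join (h : IsEdgeJoin G G' W₁ W₂ r c) (h₁ : G'.IsDeletable W₁ r n₁)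
    {S A} (hS : S.card ≤ n₂ ∧ G'.Forces W₂ W₂ S)
    (hA : HasPattern A (fun i j => i ∈ W₂ ∧ G'.Adj i j) ∧ A.rank + n₂ ≤ W₂.card) :
    G.IsDeletable (W₁ ∪ W₂) r (n₁ + n₂) := by
  obtain ⟨⟨S₁, hS₁, hf₁⟩, B, hB, hBn⟩ := h₁
  refine ⟨⟨S₁ ∪ S, ?_, h.forces_union hf₁ hS.2⟩, B + A, h.hasPattern_delete_add hB hA.1, ?_⟩
  · have := Finset.card_union_le S₁ S
    omega
  · have := rank_matrix_add_le B A
    have := h.card_union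
    omega

theorem IsExtendable.join_isDeletable (h : IsEdgeJoin G G' W₁ W₂ r c)
    (h₁ : G'.IsExtendable W₁ r n₁ ε) (h₂ : G'.IsDeletable W₂ c n₂) :
    G.IsExtendable (W₁ ∪ W₂) r (n₁ + n₂) ε := by
  obtain ⟨A₂, hA₂, hA₂n⟩ := h₂.exists_matrix h.right_mem h.right_closed
  obtain ⟨⟨A, hA, hAn⟩, ⟨S, hrS, hSn, hS⟩, ⟨S', hrS', hSn', hS'⟩, B, hB, hBn⟩ := h₁
  obtain ⟨⟨S₂, hS₂, hf₂⟩, B₂, hB₂, hB₂n⟩ := h₂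
  obtain ⟨E, hE2, hE⟩ := exists_hasPattern_star c (G.Adj c)
  have hcard := h.card_union
  refine ⟨⟨A + B₂ + E, h.hasPattern_add_star hA hB₂ hE, ?_⟩,
    ⟨S ∪ S₂, Finset.mem_union_left _ hrS, ?_, h.forces_union hS hf₂⟩,
    ⟨S' ∪ S₂, fun e => Finset.mem_union_left _ (hrS' e), ?_, h.forces_erase_union hS' hf₂⟩,
    B + A₂, h.hasPattern_delete_add hB hA₂, ?_⟩
  · have := rank_matrix_add_le (A + B₂) E
    have := rank_matrix_add_le A B₂
    omega
  · have := Finset.card_union_le S S₂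
    omega
  · have := Finset.card_union_le S' S₂
    omega
  · have := rank_matrix_add_le B A₂
    omega

theorem IsExtendable.join_zero (h : IsEdgeJoin G G' W₁ W₂ r c)
    (h₁ : G'.IsExtendable W₁ r n₁ 0) (h₂ : G'.IsExtendable W₂ c n₂ ε) :
    G.IsExtendable (W₁ ∪ W₂) r (n₁ + n₂ - 1) 1 := by
  obtain ⟨⟨A, hA, hAn⟩, -, ⟨S, hrS, hSn, hS⟩, B, hB, hBn⟩ := h₁
  obtain ⟨⟨A₂, hA₂, hA₂n⟩, ⟨T, hcT, hTn, hT⟩, ⟨T', -, hTn', hT'⟩, -⟩ := h₂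
  obtain ⟨E, hE1, hE⟩ := exists_hasPattern_edge r c
  have hcard := h.card_union
  have hpos := Finset.card_pos.2 ⟨c, hcT⟩
  have hpos' := Finset.card_pos.2 ⟨r, hrS rfl⟩
  refine ⟨⟨A + A₂ + E, h.hasPattern_add_edge hA hA₂ hE, ?_⟩,
    ⟨S ∪ T.erase c, Finset.mem_union_left _ (hrS rfl), ?_, h.forces_union_erase hS hT⟩,
    ⟨S.erase r ∪ T', by simp, ?_, h.forces_erase_erase_union hS hT'⟩,
    B + A₂, h.hasPattern_delete_add hB hA₂, ?_⟩
  · have := rank_matrix_add_le (A + A₂) E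
    have := rank_matrix_add_le A A₂
    omega
  · have := Finset.card_union_le S (T.erase c)
    have := Finset.card_erase_of_mem hcT
    omega
  · have := Finset.card_union_le (S.erase r) T'
    have := Finset.card_erase_of_mem (hrS rfl)
    omega
  · have := rank_matrix_add_le B A₂
    omega

theorem IsExtendable.join_one (h : IsEdgeJoin G G' W₁ W₂ r c)
    (h₁ : G'.IsExtendable W₁ r n₁ 1) (h₂ : G'.IsExtendable W₂ c n₂ ε) :
    G.IsDeletable (W₁ ∪ W₂) r (n₁ + n₂ - 1) := by
  obtain ⟨-, -, ⟨S, -, hSn, hS⟩, B, hB, hBn⟩ := h₁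
  obtain ⟨⟨A₂, hA₂, hA₂n⟩, ⟨T, hcT, hTn, hT⟩, -⟩ := h₂
  have hcard := h.card_union
  have hpos := Finset.card_pos.2 ⟨c, hcT⟩
  refine ⟨⟨S ∪ T.erase c, ?_, h.forces_union_erase hS hT⟩,
    B + A₂, h.hasPattern_delete_add hB hA₂, ?_⟩
  · have := Finset.card_union_le S (T.erase c)
    have := Finset.card_erase_of_mem hcT
    omega
  · have := rank_matrix_add_le B A₂
    omega

theorem isExtendable_singleton (h : ∀ v, ¬ G.Adj r v) : G.IsExtendable {r} r 1 0 := by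
  have key : HasPattern (0 : Matrix V V ℝ) fun i j => i ∈ ({r} : Finset V) ∧ G.Adj i j :=
    ⟨Matrix.isSymm_zero, fun i j _ => by simpa using fun e => e ▸ h j⟩
  refine ⟨⟨0, key, by simp⟩, ⟨{r}, by simp, by simp, fun X hS _ => hS⟩,
    ⟨{r}, by simp, by simp, fun X hS _ => hS⟩, 0, key.congr fun i j _ => ?_, by simp⟩
  grind

/-- Either `r` may end a path of an optimal path cover of `W`, or it may be deleted. -/
def IsTight (G : SimpleGraph V) (W : Finset V) (r : V) : Prop :=
  ∃ n, G.IsExtendable W r n 0 ∨ G.IsExtendable W r n 1 ∨ G.IsDeletable W r n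

theorem IsTight.join (h : IsEdgeJoin G G' W₁ W₂ r c) (h₁ : G'.IsTight W₁ r)
    (h₂ : G'.IsTight W₂ c) : G.IsTight (W₁ ∪ W₂) r := by
  obtain ⟨n₁, h₁⟩ := h₁
  obtain ⟨n₂, h₂⟩ := h₂
  have h₂' : (∃ ε, G'.IsExtendable W₂ c n₂ ε) ∨ G'.IsDeletable W₂ c n₂ := by
    rcases h₂ with h₂ | h₂ | h₂
    exacts [.inl ⟨_, h₂⟩, .inl ⟨_, h₂⟩, .inr h₂]
  rcases h₂' with ⟨ε, h₂⟩ | h₂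
  · rcases h₁ with h₁ | h₁ | h₁
    · exact ⟨_, .inr (.inl (h₁.join_zero h h₂))⟩
    · exact ⟨_, .inr (.inr (h₁.join_one h h₂))⟩
    · obtain ⟨⟨A, hA⟩, ⟨S, -, hS⟩, -⟩ := h₂
      exact ⟨_, .inr (.inr (h₁.join h hS hA))⟩
  · rcases h₁ with h₁ | h₁ | h₁
    · exact ⟨_, .inl (h₁.join_isDeletable h h₂)⟩
    · exact ⟨_, .inr (.inl (h₁.join_isDeletable h h₂))⟩
    · obtain ⟨A, hA⟩ := h₂.exists_matrix h.right_mem h.right_closed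
      obtain ⟨⟨S, hS⟩, -⟩ := h₂
      exact ⟨_, .inr (.inr (h₁.join h hS hA))⟩

theorem IsTight.exists_rank_add_card_le (h : G.IsTight W r) (hr : r ∈ W)
    (hW : ∀ i j, G.Adj i j → (i ∈ W ↔ j ∈ W)) :
    ∃ (A : Matrix V V ℝ) (S : Finset V), HasPattern A (fun i j => i ∈ W ∧ G.Adj i j) ∧
      G.Forces W W S ∧ A.rank + S.card ≤ W.card := by
  have key : ∃ n, (∃ A : Matrix V V ℝ, HasPattern A (fun i j => i ∈ W ∧ G.Adj i j) ∧
      A.rank + n ≤ W.card) ∧ ∃ S : Finset V, S.card ≤ n ∧ G.Forces W W S := by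
    obtain ⟨n, ⟨hA, ⟨S, -, hS⟩, -⟩ | ⟨hA, ⟨S, -, hS⟩, -⟩ | h⟩ := h
    · exact ⟨n, hA, S, hS⟩
    · exact ⟨n, hA, S, hS⟩
    · exact ⟨n, h.exists_matrix hr hW, h.1⟩
  obtain ⟨n, ⟨A, hA, hAn⟩, S, hSn, hS⟩ := key
  exact ⟨A, S, hA, hS, by omega⟩

end Join

theorem IsAcyclic.isEdgeJoin_deleteEdges {G : SimpleGraph V} (hG : G.IsAcyclic) {r c : V}
    (hrc : G.Adj r c) {W₁ W₂ : Finset V}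
    (h₁ : ∀ v, v ∈ W₁ ↔ (G.deleteEdges {s(r, c)}).Reachable r v)
    (h₂ : ∀ v, v ∈ W₂ ↔ (G.deleteEdges {s(r, c)}).Reachable c v) :
    IsEdgeJoin G (G.deleteEdges {s(r, c)}) W₁ W₂ r c where
  adj_iff i j := by
    simp only [deleteEdges_adj, Set.mem_singleton_iff, Sym2.eq_iff]
    have := hrc.symm
    grind
  left_mem := (h₁ r).2 .rfl
  right_mem := (h₂ c).2 .rfl
  disj v hv hv' := by
    have := isAcyclic_iff_forall_adj_isBridge.1 hG hrc
    rw [isBridge_iff] at this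
    exact this (((h₁ v).1 hv).trans ((h₂ v).1 hv').symm)
  left_closed i j hij := by
    rw [h₁, h₁]
    exact ⟨fun h => h.trans hij.reachable, fun h => h.trans hij.symm.reachable⟩
  right_closed i j hij := by
    rw [h₂, h₂]
    exact ⟨fun h => h.trans hij.reachable, fun h => h.trans hij.symm.reachable⟩

theorem reachable_iff_deleteEdges {G : SimpleGraph V} {r c : V} (hrc : G.Adj r c) (v : V) :
    G.Reachable r v ↔ (G.deleteEdges {s(r, c)}).Reachable r v ∨
      (G.deleteEdges {s(r, c)}).Reachable c v := by
  have hle := deleteEdges_le (G := G) {s(r, c)}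
  refine ⟨fun h => ?_, fun h => h.elim (·.mono hle) fun h => hrc.reachable.trans (h.mono hle)⟩
  rw [reachable_iff_reflTransGen] at h
  induction h with
  | refl => exact .inl .rfl
  | @tail a b _ hab ih =>
    by_cases he : s(a, b) = s(r, c)
    · rcases Sym2.eq_iff.1 he with ⟨-, rfl⟩ | ⟨-, rfl⟩
      · exact .inr .rfl
      · exact .inl .rfl
    · have hab' : (G.deleteEdges {s(r, c)}).Adj a b := by
        rw [deleteEdges_adj]
        exact ⟨hab, he⟩
      exact ih.imp (·.trans hab'.reachable) (·.trans hab'.reachable)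

theorem IsAcyclic.isTight [Fintype V] [DecidableEq V] {G : SimpleGraph V} (hG : G.IsAcyclic)
    (r : V) (W : Finset V) (hW : ∀ v, v ∈ W ↔ G.Reachable r v) : G.IsTight W r := by
  classical
  induction hn : G.edgeSet.ncard using Nat.strong_induction_on generalizing G r W with
  | _ n ih =>
  by_cases hr : ∃ c, G.Adj r c
  · obtain ⟨c, hrc⟩ := hr
    set G' := G.deleteEdges {s(r, c)} with hG'
    have hlt : G'.edgeSet.ncard < n := by
      rw [← hn, hG', edgeSet_deleteEdges]
      exact Set.ncard_sdiff_singleton_lt_of_mem hrc (Set.toFinite _)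
    have hac : G'.IsAcyclic := hG.anti (deleteEdges_le _)
    have h₁ : ∀ v, v ∈ Finset.univ.filter (G'.Reachable r) ↔ G'.Reachable r v := by simp
    have h₂ : ∀ v, v ∈ Finset.univ.filter (G'.Reachable c) ↔ G'.Reachable c v := by simp
    have hWe : W = Finset.univ.filter (G'.Reachable r) ∪ Finset.univ.filter (G'.Reachable c) := by
      ext v
      rw [hW, reachable_iff_deleteEdges hrc, Finset.mem_union, h₁, h₂]
    rw [hWe]
    exact (ih _ hlt hac r _ h₁ rfl).join (hG.isEdgeJoin_deleteEdges hrc h₁ h₂)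
      (ih _ hlt hac c _ h₂ rfl)
  · push Not at hr
    have hWe : W = {r} := by
      ext v
      rw [hW, Finset.mem_singleton, reachable_iff_reflTransGen]
      constructor
      · intro h
        rcases h.cases_head with h | ⟨c, h, -⟩
        · exact h.symm
        · exact absurd h (hr c)
      · rintro rfl
        exact .refl
    rw [hWe]
    exact ⟨1, .inl (isExtendable_singleton hr)⟩

theorem IsTree.exists_rank_add_card_le [Fintype V] [DecidableEq V] {G : SimpleGraph V}
    (hG : G.IsTree) : ∃ (A : Matrix V V ℝ) (S : Finset V), HasPattern A G.Adj ∧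
      G.IsZeroForcingSet (S : Set V) ∧ A.rank + S.card ≤ Fintype.card V := by
  obtain ⟨r⟩ := hG.1.nonempty
  obtain ⟨A, S, hA, hS, hAS⟩ :=
    (hG.2.isTight r Finset.univ fun v => by simp [hG.1.preconnected r v]).exists_rank_add_card_le
      (Finset.mem_univ r) (by simp)
  exact ⟨A, S, hA.congr (by simp), hS.isZeroForcingSet, hAS⟩

theorem ZFClosure.eq_zero [Fintype V] {G : SimpleGraph V} {S : Set V} {A : Matrix V V ℝ}
    (hA : HasPattern A G.Adj) {x : V → ℝ} (hx : A.mulVec x = 0) (hS : ∀ s ∈ S, x s = 0) {v : V}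
    (hv : G.ZFClosure S v) : x v = 0 := by
  induction hv with
  | init v hv => exact hS v hv
  | force u w _ huw _ ihu ih =>
    have h := congrFun hx u
    rw [Matrix.mulVec, dotProduct, Finset.sum_eq_single w, Pi.zero_apply] at h
    · exact (mul_eq_zero.1 h).resolve_left ((hA.2 u w huw.ne).2 huw)
    · intro b _ hbw
      by_cases hub : u = b
      · rw [← hub, ihu, mul_zero]
      · by_cases hadj : G.Adj u b
        · rw [ih b hadj hbw, mul_zero]
        · rw [not_not.1 (mt (hA.2 u b hub).1 hadj), zero_mul]
    · simp

theorem IsZeroForcingSet.card_le_rank_add_card_s1 [Fintype V] {G : SimpleGraph V} {S : Finset V}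
    (hS : G.IsZeroForcingSet (S : Set V)) {A : Matrix V V ℝ} (hA : HasPattern A G.Adj) :
    Fintype.card V ≤ A.rank + S.card := by
  have hrn := LinearMap.finrank_range_add_finrank_ker A.mulVecLin
  let f : LinearMap.ker A.mulVecLin →ₗ[ℝ] (S → ℝ) :=
    LinearMap.funLeft ℝ ℝ (Subtype.val : S → V) ∘ₗ (LinearMap.ker A.mulVecLin).subtype
  have hf : Function.Injective f := by
    rw [← LinearMap.ker_eq_bot, LinearMap.ker_eq_bot']
    rintro ⟨x, hx⟩ hfx
    ext v
    exact (hS v).eq_zero hA (by simpa using hx) fun s hs => congrFun hfx ⟨s, hs⟩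
  have hle := LinearMap.finrank_le_finrank_of_injective hf
  rw [Module.finrank_fintype_fun_eq_card, Fintype.card_coe] at hle
  rw [Module.finrank_fintype_fun_eq_card] at hrn
  rw [Matrix.rank]
  omega

end SimpleGraph

/-- If `T` is a tree on `N` vertices, then `mr(T) = N − Z(T)`. -/
theorem minRank_eq_card_sub_zeroForcingNumber_of_tree {V : Type*} [Fintype V] [DecidableEq V]
    (G : SimpleGraph V) (hG : G.IsTree) :
    G.minRank = Fintype.card V - G.zeroForcingNumber := by
  obtain ⟨A, S, hA, hS, hAS⟩ := hG.exists_rank_add_card_le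
  have hr : G.minRank ≤ A.rank := Nat.sInf_le ⟨A, hA.1, hA.2, rfl⟩
  have hz : G.zeroForcingNumber ≤ S.card := Nat.sInf_le ⟨S, rfl, hS⟩
  obtain ⟨A', hA', hpat, hr'⟩ : ∃ A : Matrix V V ℝ, A.IsSymm ∧
      (∀ i j, i ≠ j → (A i j ≠ 0 ↔ G.Adj i j)) ∧ A.rank = G.minRank :=
    Nat.sInf_mem (s := {r | ∃ A : Matrix V V ℝ, A.IsSymm ∧
      (∀ i j, i ≠ j → (A i j ≠ 0 ↔ G.Adj i j)) ∧ A.rank = r}) ⟨_, A, hA.1, hA.2, rfl⟩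
  obtain ⟨S', hz', hS'⟩ : ∃ S : Finset V, S.card = G.zeroForcingNumber ∧
      G.IsZeroForcingSet (S : Set V) :=
    Nat.sInf_mem (s := {n | ∃ S : Finset V, S.card = n ∧ G.IsZeroForcingSet (S : Set V)})
      ⟨_, S, rfl, hS⟩
  have := hS'.card_le_rank_add_card_s1 ⟨hA', hpat⟩
  omega
end
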